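/- Let A be a finitely generated k-algebra that is prime, noetherian, Auslander–Gorenstein and Cohen–Macaulay with GKdim(A) = 2. If A is hereditary, then A is simple. -/

import Mathlib

/- STATEMENT 11:
Let `A` be a finitely generated `k`-algebra that is prime, noetherian, Auslander–Gorenstein and
Cohen–Macaulay with `GKdim A = 2`. If `A` is hereditary, then `A` is simple.

Right `A`-modules are modules over `Aᵐᵒᵖ`. The Auslander condition is expressed by saying that
for `p < q` and any finitely generated right module `M`, every (left) module embedding into
`Ext^q(M, A)` (compatible with the natural left `A`-action on `Ext^q(M, A)`, induced
functorially by right multiplications on `A`) has grade at least `q` — in particular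
`Ext^p` of it into `A` vanishes for `p < q`. The Cohen–Macaulay property is
`j(M) + GKdim(M) = GKdim(A) = 2` for all finitely generated modules `M`, with GK-dimension
expressed via growth of finite-dimensional subspaces. -/

noncomputable section

def IsPrimeRing (A : Type) [Ring A] : Prop :=
  ∀ a b : A, (∀ x : A, a * x * b = 0) → a = 0 ∨ b = 0

noncomputable abbrev extGrp (B : Type) [Ring B] (n : ℕ) (M N : ModuleCat B) : Type :=
  ((Ext ℤ (ModuleCat B) n).obj (Opposite.op M)).obj N

/-- Right(-and-left) hereditary: global dimension at most one. -/
def IsHereditaryRing (A : Type) [Ring A] : Prop :=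
  (∀ (M N : ModuleCat Aᵐᵒᵖ) (n : ℕ), 1 < n → Subsingleton (extGrp Aᵐᵒᵖ n M N)) ∧
  (∀ (M N : ModuleCat A) (n : ℕ), 1 < n → Subsingleton (extGrp A n M N))

def RightSelfInjDimLE (A : Type) [Ring A] (d : ℕ) : Prop :=
  ∀ (M : ModuleCat Aᵐᵒᵖ) (n : ℕ), d < n →
    Subsingleton (extGrp Aᵐᵒᵖ n M (ModuleCat.of Aᵐᵒᵖ Aᵐᵒᵖ))

def LeftSelfInjDimLE (A : Type) [Ring A] (d : ℕ) : Prop :=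
  ∀ (M : ModuleCat A) (n : ℕ), d < n →
    Subsingleton (extGrp A n M (ModuleCat.of A A))

/-- Right multiplication by `a` on the right regular module, as an endomorphism in the
category of right `A`-modules. -/
def rightMulEnd (A : Type) [Ring A] (a : A) :
    ModuleCat.of Aᵐᵒᵖ Aᵐᵒᵖ ⟶ ModuleCat.of Aᵐᵒᵖ Aᵐᵒᵖ :=
  ModuleCat.ofHom
    { toFun := fun x => x * MulOpposite.op a
      map_add' := fun x y => add_mul x y _
      map_smul' := fun c x => by simp [smul_eq_mul, mul_assoc] }

/-- The natural left `A`-action on `Ext^q(M, A)` for a right `A`-module `M`, induced by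
right multiplication on `A`. -/
def extAct (A : Type) [Ring A] (q : ℕ) (M : ModuleCat Aᵐᵒᵖ) (a : A) :
    extGrp Aᵐᵒᵖ q M (ModuleCat.of Aᵐᵒᵖ Aᵐᵒᵖ) → extGrp Aᵐᵒᵖ q M (ModuleCat.of Aᵐᵒᵖ Aᵐᵒᵖ) :=
  fun x => ((Ext ℤ (ModuleCat Aᵐᵒᵖ) q).obj (Opposite.op M)).map (rightMulEnd A a) x

/-- Left multiplication by `a` on the left regular module. -/
def leftMulEnd (A : Type) [Ring A] (a : A) : ModuleCat.of A A ⟶ ModuleCat.of A A :=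
  ModuleCat.ofHom
    { toFun := fun x => x * a
      map_add' := fun x y => add_mul x y _
      map_smul' := fun c x => by simp [smul_eq_mul, mul_assoc] }

/-- The natural right `A`-action on `Ext^q(M, A)` for a left `A`-module `M`. -/
def extActL (A : Type) [Ring A] (q : ℕ) (M : ModuleCat A) (a : A) :
    extGrp A q M (ModuleCat.of A A) → extGrp A q M (ModuleCat.of A A) :=
  fun x => ((Ext ℤ (ModuleCat A) q).obj (Opposite.op M)).map (leftMulEnd A a) x

/-- The Auslander condition (for right modules): if `p < q`, `M` is a finitely generated right
`A`-module and `N` is a (left) `A`-submodule of `Ext^q_A(M, A)`, then `Ext^p_A(N, A) = 0`. -/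
def AuslanderConditionRight (A : Type) [Ring A] : Prop :=
  ∀ (p q : ℕ), p < q → ∀ (M : ModuleCat Aᵐᵒᵖ), Module.Finite Aᵐᵒᵖ M →
  ∀ (N : Type) [AddCommGroup N] [Module A N],
    (∃ φ : N →+ extGrp Aᵐᵒᵖ q M (ModuleCat.of Aᵐᵒᵖ Aᵐᵒᵖ), Function.Injective φ ∧
        ∀ (a : A) (n : N), φ (a • n) = extAct A q M a (φ n)) →
    Subsingleton (extGrp A p (ModuleCat.of A N) (ModuleCat.of A A))

/-- The Auslander condition for left modules. -/
def AuslanderConditionLeft (A : Type) [Ring A] : Prop :=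
  ∀ (p q : ℕ), p < q → ∀ (M : ModuleCat A), Module.Finite A M →
  ∀ (N : Type) [AddCommGroup N] [Module Aᵐᵒᵖ N],
    (∃ φ : N →+ extGrp A q M (ModuleCat.of A A), Function.Injective φ ∧
        ∀ (a : A) (n : N), φ ((MulOpposite.op a) • n) = extActL A q M a (φ n)) →
    Subsingleton (extGrp Aᵐᵒᵖ p (ModuleCat.of Aᵐᵒᵖ N) (ModuleCat.of Aᵐᵒᵖ Aᵐᵒᵖ))

/-- `A` is Auslander–Gorenstein: finite injective dimension on both sides, plus the Auslander
condition on both sides. -/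
def AuslanderGorenstein (A : Type) [Ring A] : Prop :=
  (∃ d : ℕ, RightSelfInjDimLE A d ∧ LeftSelfInjDimLE A d) ∧
  AuslanderConditionRight A ∧ AuslanderConditionLeft A

/-- The span of `{m • a : a ∈ (V ⊔ k)^n, m ∈ F}`: the growth spaces of the right module `M`. -/
def prodSub (k A : Type) [Field k] [Ring A] [Algebra k A] (M : Type) [AddCommGroup M]
    [Module Aᵐᵒᵖ M] [Module k M] (V : Submodule k A) (F : Submodule k M) (n : ℕ) :
    Submodule k M :=
  Submodule.span k
    (Set.image2 (fun (a : A) (m : M) => (MulOpposite.op a) • m)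
      ((((V ⊔ 1) ^ n : Submodule k A) : Set A)) (F : Set M))

/-- `GKdim_k(M) ≤ d` (real exponent `d`): polynomially bounded growth of exponent `≤ d`. -/
def ModGKLE (k A : Type) [Field k] [Ring A] [Algebra k A] (M : Type) [AddCommGroup M]
    [Module Aᵐᵒᵖ M] [Module k M] (d : ℝ) : Prop :=
  ∀ (V : Submodule k A) (F : Submodule k M), FiniteDimensional k V → FiniteDimensional k F →
    ∀ ε : ℝ, 0 < ε → ∃ C : ℝ, ∀ n : ℕ,
      (Module.finrank k (prodSub k A M V F n) : ℝ) ≤ C * ((n : ℝ) + 1) ^ (d + ε)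

/-- `GKdim_k(M) ≥ d`. -/
def ModGKGE (k A : Type) [Field k] [Ring A] [Algebra k A] (M : Type) [AddCommGroup M]
    [Module Aᵐᵒᵖ M] [Module k M] (d : ℝ) : Prop :=
  ∃ (V : Submodule k A) (F : Submodule k M), FiniteDimensional k V ∧ FiniteDimensional k F ∧
    ∀ ε : ℝ, 0 < ε → ∀ N : ℕ, ∃ n, N ≤ n ∧
      ((n : ℝ)) ^ (d - ε) ≤ (Module.finrank k (prodSub k A M V F n) : ℝ)

/-- `GKdim_k(A) ≤ d` for the algebra `A` itself. -/
def RingGKLE (k A : Type) [Field k] [Ring A] [Algebra k A] (d : ℝ) : Prop :=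
  ∀ V : Submodule k A, FiniteDimensional k V → ∀ ε : ℝ, 0 < ε → ∃ C : ℝ, ∀ n : ℕ,
    (Module.finrank k (((V ⊔ 1) ^ n : Submodule k A)) : ℝ) ≤ C * ((n : ℝ) + 1) ^ (d + ε)

/-- `GKdim_k(A) ≥ d` for the algebra `A` itself. -/
def RingGKGE (k A : Type) [Field k] [Ring A] [Algebra k A] (d : ℝ) : Prop :=
  ∃ V : Submodule k A, FiniteDimensional k V ∧
    ∀ ε : ℝ, 0 < ε → ∀ N : ℕ, ∃ n, N ≤ n ∧
      ((n : ℝ)) ^ (d - ε) ≤ (Module.finrank k (((V ⊔ 1) ^ n : Submodule k A)) : ℝ)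

/-- The Cohen–Macaulay property for `A` with `GKdim A = 2`:
`j(M) + GKdim(M) = 2` for every nonzero finitely generated right `A`-module `M`. -/
def CohenMacaulayGK2 (k A : Type) [Field k] [Ring A] [Algebra k A] : Prop :=
  ∀ (M : Type) [AddCommGroup M] [Module Aᵐᵒᵖ M] [Module k M] [IsScalarTower k Aᵐᵒᵖ M],
    Module.Finite Aᵐᵒᵖ M → Nontrivial M →
    ∀ j : ℕ,
      (Nontrivial (extGrp Aᵐᵒᵖ j (ModuleCat.of Aᵐᵒᵖ M) (ModuleCat.of Aᵐᵒᵖ Aᵐᵒᵖ)) ∧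
        ∀ i : ℕ, i < j →
          Subsingleton (extGrp Aᵐᵒᵖ i (ModuleCat.of Aᵐᵒᵖ M) (ModuleCat.of Aᵐᵒᵖ Aᵐᵒᵖ))) →
      (ModGKLE k A M ((2 : ℝ) - j) ∧ ModGKGE k A M ((2 : ℝ) - j))

open CategoryTheory in
theorem exists_factor_of_subsingleton_ext {B : Type} [Ring B] {M N : ModuleCat B}
    (P : ProjectiveResolution M) (n : ℕ) (h : Subsingleton (extGrp B (n + 1) M N))
    (f : P.complex.X (n + 1) ⟶ N) (hf : P.complex.d (n + 2) (n + 1) ≫ f = 0) :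
    ∃ s : P.complex.X n ⟶ N, P.complex.d (n + 1) n ≫ s = f := by
  have h0 : Limits.IsZero ((P.complex.linearYonedaObj ℤ N).homology (n + 1)) :=
    Limits.IsZero.of_iso (ModuleCat.isZero_of_subsingleton _) (P.isoExt (n + 1) N).symm
  rw [← HomologicalComplex.exactAt_iff_isZero_homology,
    HomologicalComplex.exactAt_iff' _ n (n + 1) (n + 2) (by simp) (by simp),
    ShortComplex.moduleCat_exact_iff] at h0
  exact h0 f hf

open CategoryTheory in
theorem subsingleton_ext_zero {B : Type} [Ring B] {M N : ModuleCat B}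
    (h : ∀ f : M ⟶ N, f = 0) : Subsingleton (extGrp B 0 M N) := by
  let P := projectiveResolution M
  have h0 : Limits.IsZero ((P.complex.linearYonedaObj ℤ N).homology 0) := by
    rw [← HomologicalComplex.exactAt_iff_isZero_homology,
      HomologicalComplex.exactAt_iff' _ 0 0 1 (by simp) (by simp),
      ShortComplex.moduleCat_exact_iff]
    intro (g : P.complex.X 0 ⟶ N) (hg : P.complex.d 1 0 ≫ g = 0)
    let s := Limits.IsColimit.desc P.isColimitCokernelCofork (Limits.CokernelCofork.ofπ g hg)
    have hs : P.π.f 0 ≫ s = g :=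
      P.isColimitCokernelCofork.fac (Limits.CokernelCofork.ofπ g hg) Limits.WalkingParallelPair.one
    have : g = 0 := by
      rw [← hs, show s = 0 from h s]
      exact Limits.comp_zero
    exact ⟨0, by rw [this]; simp; rfl⟩
  exact ModuleCat.subsingleton_of_isZero (Limits.IsZero.of_iso h0 (P.isoExt 0 N))

open CategoryTheory in
theorem exists_resolution_start {B : Type} [Ring B] (M : Type) [AddCommGroup M] [Module B M] :
    ∃ (P₀ P₁ P₂ : ModuleCat.{0} B) (d₂ : P₂ →ₗ[B] P₁) (d₁ : P₁ →ₗ[B] P₀) (π : P₀ →ₗ[B] M),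
      Module.Projective B P₀ ∧ Module.Projective B P₁ ∧ Function.Surjective π ∧
      Function.Exact d₁ π ∧ Function.Exact d₂ d₁ ∧
      (∀ N : ModuleCat B, Subsingleton (extGrp B 1 (ModuleCat.of B M) N) →
        ∀ f : P₁ →ₗ[B] N, f ∘ₗ d₂ = 0 → ∃ s : P₀ →ₗ[B] N, s ∘ₗ d₁ = f) ∧
      (∀ N : ModuleCat B, Subsingleton (extGrp B 2 (ModuleCat.of B M) N) →
        ∀ f : P₂ →ₗ[B] N, (∀ x, d₂ x = 0 → f x = 0) → ∃ s : P₁ →ₗ[B] N, s ∘ₗ d₂ = f) := by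
  let P := projectiveResolution (ModuleCat.of B M)
  let π : P.complex.X 0 ⟶ ModuleCat.of B M := P.π.f 0
  have hπ : Epi π := inferInstanceAs (Epi (P.π.f 0))
  have hdd (n : ℕ) (x : P.complex.X (n + 2)) :
      P.complex.d (n + 1) n (P.complex.d (n + 2) (n + 1) x) = 0 := by
    rw [← ModuleCat.comp_apply, P.complex.d_comp_d]; rfl
  have hex : (ShortComplex.mk (P.complex.d 1 0) π P.complex_d_comp_π_f_zero).Exact :=
    ShortComplex.exact_of_g_is_cokernel _ P.isColimitCokernelCofork
  refine ⟨P.complex.X 0, P.complex.X 1, P.complex.X 2, (P.complex.d 2 1).hom,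
    (P.complex.d 1 0).hom, π.hom, ?_, ?_, (ModuleCat.epi_iff_surjective π).1 hπ, ?_, ?_, ?_, ?_⟩
  · exact (IsProjective.iff_projective _).2 (P.projective 0)
  · exact (IsProjective.iff_projective _).2 (P.projective 1)
  · exact (ShortComplex.ShortExact.moduleCat_exact_iff_function_exact _).1 hex
  · exact (ShortComplex.ShortExact.moduleCat_exact_iff_function_exact _).1 (P.exact_succ 0)
  · intro N hN f hf
    obtain ⟨s, hs⟩ := exists_factor_of_subsingleton_ext P 0 hN (ModuleCat.ofHom f)
      (ModuleCat.hom_ext hf)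
    exact ⟨s.hom, congrArg ModuleCat.Hom.hom hs⟩
  · intro N hN f hf
    obtain ⟨s, hs⟩ := exists_factor_of_subsingleton_ext P 1 hN (ModuleCat.ofHom f)
      (ModuleCat.hom_ext (LinearMap.ext fun x => hf _ (hdd 1 x)))
    exact ⟨s.hom, congrArg ModuleCat.Hom.hom hs⟩

/-- If `Ext¹(B/J, N) = 0`, then every homomorphism `J → N` extends to `B`. -/
theorem exists_extension_of_subsingleton_ext_one {B : Type} [Ring B] (J : Submodule B B)
    (N : ModuleCat B) (h : Subsingleton (extGrp B 1 (ModuleCat.of B (B ⧸ J)) N))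
    (f : J →ₗ[B] N) : ∃ g : B →ₗ[B] N, ∀ x : J, g x = f x := by
  obtain ⟨P₀, P₁, P₂, d₂, d₁, π, hP₀, hP₁, hπ, h₁, h₂, hE, -⟩ := exists_resolution_start (B := B) (B ⧸ J)
  obtain ⟨α, hα⟩ := Module.projective_lifting_property J.mkQ π J.mkQ_surjective
  obtain ⟨p, hp⟩ := hπ (J.mkQ 1)
  have hα' (x : P₀) : J.mkQ (α x) = π x := LinearMap.congr_fun hα x
  have hmem (x : P₁) : α (d₁ x) ∈ J := by
    rw [← Submodule.Quotient.mk_eq_zero, ← Submodule.mkQ_apply, hα', h₁.apply_apply_eq_zero]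
  let α₁ : P₁ →ₗ[B] J := (α ∘ₗ d₁).codRestrict J hmem
  obtain ⟨s, hs⟩ := hE N h (f ∘ₗ α₁) (LinearMap.ext fun x => by
    have : α₁ (d₂ x) = 0 := Subtype.ext (by simp [α₁, h₂.apply_apply_eq_zero])
    simp [this])
  have hj : 1 - α p ∈ J := by
    rw [← Submodule.Quotient.mk_eq_zero, ← Submodule.mkQ_apply, map_sub, hα', hp, sub_self]
  refine ⟨LinearMap.toSpanSingleton B N (s p + f ⟨_, hj⟩), fun y => ?_⟩
  have hy : π ((y : B) • p) = 0 := by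
    rw [map_smul, hp, ← map_smul, Submodule.mkQ_apply, Submodule.Quotient.mk_eq_zero]
    simp
  obtain ⟨q, hq⟩ := (h₁ _).1 hy
  have e : s ((y : B) • p) = f (α₁ q) := by
    rw [← hq]; exact LinearMap.congr_fun hs q
  rw [LinearMap.toSpanSingleton_apply, smul_add, ← map_smul, e, ← map_smul, ← map_add]
  congr 1
  apply Subtype.ext
  simp [α₁, hq, mul_sub]

/-- If `Ext²(B/J, -) = 0`, then the left ideal `J` is projective. -/
theorem projective_of_subsingleton_ext_two {B : Type} [Ring B] (J : Submodule B B)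
    (h : ∀ N : ModuleCat.{0} B, Subsingleton (extGrp B 2 (ModuleCat.of B (B ⧸ J)) N)) :
    Module.Projective B J := by
  obtain ⟨P₀, P₁, P₂, d₂, d₁, π, hP₀, hP₁, hπ, h₁, h₂, -, hE⟩ := exists_resolution_start (B := B) (B ⧸ J)
  have hα := Module.projective_lifting_property J.mkQ π J.mkQ_surjective
  have hβ := Module.projective_lifting_property π J.mkQ hπ
  obtain ⟨α, hα⟩ := hα
  obtain ⟨β, hβ⟩ := hβ
  have hα' (x : P₀) : J.mkQ (α x) = π x := LinearMap.congr_fun hα x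
  have hβ' (x : B) : π (β x) = J.mkQ x := LinearMap.congr_fun hβ x
  -- the first syzygy of the resolution is projective
  have hK : Module.Projective B (LinearMap.ker π) := by
    obtain ⟨s, hs⟩ := hE (ModuleCat.of B (LinearMap.range d₂)) (h _) d₂.rangeRestrict
      (fun x hx => Subtype.ext hx)
    let e : P₁ →ₗ[B] P₁ := LinearMap.id - (LinearMap.range d₂).subtype ∘ₗ s
    have he (x : P₁) (hx : d₁ x = 0) : e x = 0 := by
      obtain ⟨y, rfl⟩ := (h₂ x).1 hx
      have := LinearMap.congr_fun hs y
      simp only [LinearMap.comp_apply] at this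
      simp [e, this]
    have hd (x : P₁) : d₁ (e x) = d₁ x := by
      obtain ⟨y, hy⟩ := (s x).2
      simp only [e, LinearMap.sub_apply, LinearMap.id_apply, LinearMap.comp_apply,
        Submodule.subtype_apply, map_sub]
      rw [← hy, h₂.apply_apply_eq_zero, sub_zero]
    let d₁' : P₁ →ₗ[B] LinearMap.ker π :=
      d₁.codRestrict _ (fun x => h₁.apply_apply_eq_zero x)
    have hsurj : Function.Surjective d₁' := fun ⟨x, hx⟩ => by
      obtain ⟨y, hy⟩ := (h₁ x).1 hx
      exact ⟨y, Subtype.ext hy⟩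
    have hker : LinearMap.ker d₁' ≤ LinearMap.ker e := fun x hx =>
      he x (congrArg Subtype.val hx)
    let σ : LinearMap.ker π →ₗ[B] P₁ :=
      (Submodule.liftQ _ e hker) ∘ₗ (d₁'.quotKerEquivOfSurjective hsurj).symm.toLinearMap
    refine Module.Projective.of_split σ d₁' (LinearMap.ext fun x => ?_)
    obtain ⟨y, rfl⟩ := hsurj x
    have : (d₁'.quotKerEquivOfSurjective hsurj).symm (d₁' y) = Submodule.Quotient.mk y := by
      rw [LinearEquiv.symm_apply_eq]; rfl
    simp only [σ, LinearMap.comp_apply, LinearEquiv.coe_coe, this, Submodule.liftQ_apply,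
      LinearMap.id_apply]
    exact Subtype.ext (hd y)
  have hmemα (x : LinearMap.ker π) : α x ∈ J := by
    rw [← Submodule.Quotient.mk_eq_zero, ← Submodule.mkQ_apply, hα', x.2]
  have hmemβ (x : J) : β x ∈ LinearMap.ker π := by
    rw [LinearMap.mem_ker, hβ', Submodule.mkQ_apply, Submodule.Quotient.mk_eq_zero]; exact x.2
  have hmemγ (x : B) : x - α (β x) ∈ J := by
    rw [← Submodule.Quotient.mk_eq_zero, ← Submodule.mkQ_apply, map_sub, hα', hβ', sub_self]
  let α' : LinearMap.ker π →ₗ[B] J := (α ∘ₗ Submodule.subtype _).codRestrict J hmemα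
  let β' : J →ₗ[B] LinearMap.ker π := (β ∘ₗ Submodule.subtype _).codRestrict _ hmemβ
  let γ : B →ₗ[B] J := (LinearMap.id - α ∘ₗ β).codRestrict J hmemγ
  refine Module.Projective.of_split (β'.prod J.subtype) (α'.coprod γ)
    (LinearMap.ext fun x => Subtype.ext ?_)
  exact add_sub_cancel (α (β x)) (x : B)

/-- In a ring where every `y` with `I y = 0` vanishes, a finitely generated projective left ideal
`J ⊇ I` all of whose functionals extend to `J' ⊇ J` equals `J'`. -/
theorem eq_of_functionals_extend {R : Type*} [Ring R] (I : Ideal R) [I.IsTwoSided]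
    (hI : ∀ y : R, (∀ i ∈ I, i * y = 0) → y = 0) {J J' : Submodule R R} (hIJ : I ≤ J)
    (hJ : J ≤ J') [Module.Finite R J] [Module.Projective R J]
    (h : ∀ g : J →ₗ[R] R, ∃ g' : J' →ₗ[R] R, ∀ x : J, g' ⟨x, hJ x.2⟩ = g x) : J = J' := by
  refine le_antisymm hJ fun x hx => ?_
  obtain ⟨n, f, hf⟩ := Module.Finite.exists_fin' R J
  obtain ⟨σ, hσ⟩ := Module.projective_lifting_property f LinearMap.id hf
  choose g hg using fun l : Fin n => h (LinearMap.proj l ∘ₗ σ)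
  let φ : J' →ₗ[R] J := f ∘ₗ LinearMap.pi g
  have hφ (y : J) : φ ⟨y, hJ y.2⟩ = y := by
    have : LinearMap.pi g ⟨y, hJ y.2⟩ = σ y := funext fun l => hg l y
    rw [LinearMap.comp_apply, this]
    exact LinearMap.congr_fun hσ y
  have hxφ : (φ ⟨x, hx⟩ : R) - x = 0 := by
    refine hI _ fun i hi => ?_
    have hix : i * x ∈ I := I.mul_mem_right x hi
    have := congrArg Subtype.val (hφ ⟨i * x, hIJ hix⟩)
    have e : (⟨i * x, hJ (hIJ hix)⟩ : J') = i • ⟨x, hx⟩ := rfl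
    rw [e, map_smul] at this
    rw [mul_sub, sub_eq_zero]
    exact this
  rw [← sub_eq_zero.1 hxφ]
  exact (φ ⟨x, hx⟩).2

/-- A quotient of a hereditary noetherian ring by a two-sided ideal without right annihilator is
artinian. -/
theorem isArtinian_quotient {R : Type*} [Ring R] [IsNoetherianRing R] [IsNoetherian Rᵐᵒᵖ R]
    (hproj : ∀ J : Submodule R R, Module.Projective R J) (I : Ideal R) [I.IsTwoSided]
    (hI : ∀ y : R, (∀ i ∈ I, i * y = 0) → y = 0) : IsArtinian R (R ⧸ I) := by
  obtain ⟨n, f, hf⟩ := Module.Finite.exists_fin' R I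
  have hnoeth : IsNoetherian Rᵐᵒᵖ (I →ₗ[R] R) := by
    let ev : (I →ₗ[R] R) →ₗ[Rᵐᵒᵖ] (Fin n → R) :=
      { toFun := fun g l => g (f (Pi.single l 1))
        map_add' := fun _ _ => rfl
        map_smul' := fun _ _ => rfl }
    refine isNoetherian_of_injective ev fun g g' hgg => ?_
    have : g ∘ₗ f = g' ∘ₗ f := by
      refine LinearMap.pi_ext' fun l => LinearMap.ext_ring ?_
      exact congrFun hgg l
    refine LinearMap.ext fun x => ?_
    obtain ⟨y, rfl⟩ := hf x
    exact LinearMap.congr_fun this y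
  have hle (K : Submodule R (R ⧸ I)) : I ≤ K.comap I.mkQ := fun x hx => by
    have : I.mkQ x = 0 := (Submodule.Quotient.mk_eq_zero I).2 hx
    rw [Submodule.mem_comap, this]; exact K.zero_mem
  let Φ (K : Submodule R (R ⧸ I)) : Submodule Rᵐᵒᵖ (I →ₗ[R] R) :=
    { carrier := {g | ∃ g' : K.comap I.mkQ →ₗ[R] R, ∀ x : I, g' ⟨x, hle K x.2⟩ = g x}
      add_mem' := by
        rintro g₁ g₂ ⟨h₁, e₁⟩ ⟨h₂, e₂⟩
        exact ⟨h₁ + h₂, fun x => by simp [e₁, e₂]⟩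
      zero_mem' := ⟨0, fun x => rfl⟩
      smul_mem' := by
        rintro c g ⟨h, e⟩
        exact ⟨c • h, fun x => by simp [e]⟩ }
  have hanti : StrictAnti Φ := by
    intro K K' hK
    refine lt_of_le_of_ne ?_ fun heq => hK.ne ?_
    · rintro g ⟨h, e⟩
      exact ⟨h ∘ₗ Submodule.inclusion (Submodule.comap_mono hK.le), fun x => e x⟩
    · have : K.comap I.mkQ = K'.comap I.mkQ := by
        have := hproj (K.comap I.mkQ)
        refine eq_of_functionals_extend I hI (hle K) (Submodule.comap_mono hK.le) fun g => ?_
        have hg : g ∘ₗ Submodule.inclusion (hle K) ∈ Φ K' := heq ▸ ⟨g, fun x => rfl⟩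
        obtain ⟨g', hg'⟩ := hg
        refine ⟨g', fun x => sub_eq_zero.1 (hI _ fun i hi => ?_)⟩
        have hix : i * (x : R) ∈ I := I.mul_mem_right _ hi
        have h₁ : g' ⟨i * x, hle K' hix⟩ = g ⟨i * x, hle K hix⟩ := hg' ⟨i * x, hix⟩
        have e₁ : (⟨i * x, hle K' hix⟩ : K'.comap I.mkQ) =
          i • ⟨x, Submodule.comap_mono hK.le x.2⟩ := rfl
        have e₂ : (⟨i * x, hle K hix⟩ : K.comap I.mkQ) = i • x := rfl
        rw [e₁, e₂, map_smul, map_smul] at h₁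
        rw [mul_sub, sub_eq_zero]
        exact h₁
      exact Submodule.comap_injective_of_surjective I.mkQ_surjective this
  exact hanti.wellFoundedLT

/-- A simple module over an artinian ring `R/I` is finite over its endomorphism ring. -/
theorem finite_end_of_isArtinian {R M : Type*} [Ring R] [AddCommGroup M] [Module R M]
    [IsSimpleModule R M] (I : Ideal R) [IsArtinian R (R ⧸ I)]
    (hIM : ∀ i ∈ I, ∀ m : M, i • m = 0) : Module.Finite (Module.End R M) M := by
  let φ (m : M) : (R ⧸ I) →ₗ[R] M :=
    I.liftQ (LinearMap.toSpanSingleton R M m) fun i hi => hIM i hi m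
  have hφ (m : M) : φ m (I.mkQ 1) = m := one_smul R m
  obtain ⟨F, hF⟩ := Finset.exists_inf_le fun m : M => LinearMap.ker (φ m)
  let Ψ : (R ⧸ I) →ₗ[R] (F → M) := LinearMap.pi fun m => φ m
  refine ⟨⟨F, eq_top_iff.2 fun y _ => ?_⟩⟩
  have hker : LinearMap.ker Ψ ≤ LinearMap.ker (φ y) := by
    refine le_trans ?_ (hF y)
    intro x hx
    rw [Submodule.mem_finsetInf]
    exact fun m hm => congrFun hx ⟨m, hm⟩
  obtain ⟨g, hg⟩ := IsSemisimpleModule.extension_property ((LinearMap.ker Ψ).liftQ Ψ le_rfl)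
    (LinearMap.ker_eq_bot.1 (Submodule.ker_liftQ_eq_bot _ _ _ le_rfl))
    ((LinearMap.ker Ψ).liftQ (φ y) hker)
  have hgy : g (fun m => m) = y := by
    have := LinearMap.congr_fun hg (Submodule.Quotient.mk (I.mkQ 1))
    simp only [LinearMap.comp_apply, Submodule.liftQ_apply, hφ] at this
    rw [← this]
    congr 1
    ext m
    exact (hφ m).symm
  classical
  rw [← hgy, ← Finset.univ_sum_single (fun m : F => (m : M)), map_sum]
  refine Submodule.sum_mem _ fun m _ => ?_
  exact Submodule.smul_mem _ (g ∘ₗ LinearMap.single R (fun _ : F => M) m)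
    (Submodule.subset_span m.2)

theorem exists_mul_rpow_lt_sq (C : ℝ) :
    ∃ n : ℕ, C * (((2 * n : ℕ) : ℝ) + 1) ^ (3 / 2 : ℝ) < ((n : ℝ) + 1) ^ 2 := by
  obtain ⟨n, hn⟩ := exists_nat_gt ((4 * |C|) ^ 2)
  refine ⟨n, ?_⟩
  have hn1 : (0 : ℝ) < (n : ℝ) + 1 := by positivity
  have h1 : 4 * |C| < ((n : ℝ) + 1) ^ (1 / 2 : ℝ) := by
    rw [← Real.sqrt_eq_rpow]
    exact Real.lt_sqrt_of_sq_lt (by linarith)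
  have h2 : (((2 * n : ℕ) : ℝ) + 1) ^ (3 / 2 : ℝ) ≤ 4 * ((n : ℝ) + 1) ^ (3 / 2 : ℝ) := by
    calc (((2 * n : ℕ) : ℝ) + 1) ^ (3 / 2 : ℝ) ≤ (2 * ((n : ℝ) + 1)) ^ (3 / 2 : ℝ) := by
          apply Real.rpow_le_rpow (by positivity) _ (by norm_num)
          push_cast; linarith
      _ = 2 ^ (3 / 2 : ℝ) * ((n : ℝ) + 1) ^ (3 / 2 : ℝ) :=
          Real.mul_rpow (by norm_num) hn1.le
      _ ≤ 2 ^ (2 : ℝ) * ((n : ℝ) + 1) ^ (3 / 2 : ℝ) := by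
          gcongr <;> norm_num
      _ = 4 * ((n : ℝ) + 1) ^ (3 / 2 : ℝ) := by norm_num
  have h3 : ((n : ℝ) + 1) ^ (1 / 2 : ℝ) * ((n : ℝ) + 1) ^ (3 / 2 : ℝ) = ((n : ℝ) + 1) ^ 2 := by
    rw [← Real.rpow_add hn1, ← Real.rpow_natCast]; norm_num
  have h4 : (0 : ℝ) < ((n : ℝ) + 1) ^ (3 / 2 : ℝ) := by positivity
  calc C * (((2 * n : ℕ) : ℝ) + 1) ^ (3 / 2 : ℝ)
      ≤ |C| * (((2 * n : ℕ) : ℝ) + 1) ^ (3 / 2 : ℝ) := by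
        gcongr; exact le_abs_self C
    _ ≤ |C| * (4 * ((n : ℝ) + 1) ^ (3 / 2 : ℝ)) := by gcongr
    _ = 4 * |C| * ((n : ℝ) + 1) ^ (3 / 2 : ℝ) := by ring
    _ < ((n : ℝ) + 1) ^ (1 / 2 : ℝ) * ((n : ℝ) + 1) ^ (3 / 2 : ℝ) := by gcongr
    _ = _ := h3

/-- The factor of length `n` at position `a` of the infinite word `x`. -/
def wordFactor {α : Type*} (x : ℕ → α) (a n : ℕ) : List α :=
  (List.range n).map fun i => x (a + i)

theorem wordFactor_add {α : Type*} (x : ℕ → α) (a m n : ℕ) :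
    wordFactor x a (m + n) = wordFactor x a m ++ wordFactor x (a + m) n := by
  simp [wordFactor, List.range_add, Function.comp_def, add_assoc]

theorem length_wordFactor {α : Type*} (x : ℕ → α) (a n : ℕ) :
    (wordFactor x a n).length = n := by
  simp [wordFactor]

/-- Morse–Hedlund: an infinite word with at most `n` factors of length `n` is eventually
periodic. -/
theorem exists_period_of_ncard_factors_le {α : Type*} [Finite α] (x : ℕ → α) (n : ℕ)
    (hn : (Set.range fun a => wordFactor x a n).ncard ≤ n) :
    ∃ c q, 0 < q ∧ ∀ i, x (c + q + i) = x (c + i) := by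
  have hfin (j : ℕ) : (Set.range fun a => wordFactor x a j).Finite :=
    (List.finite_length_eq α j).subset (by rintro _ ⟨a, rfl⟩; exact length_wordFactor x a j)
  have htake (a j : ℕ) : (wordFactor x a (j + 1)).take j = wordFactor x a j := by
    rw [wordFactor_add, List.take_left' (length_wordFactor x a j)]
  have himage (j : ℕ) : (List.take j) '' (Set.range fun a => wordFactor x a (j + 1)) =
      Set.range fun a => wordFactor x a j := by
    rw [← Set.range_comp]
    exact congrArg Set.range (funext fun a => htake a j)
  obtain ⟨j, hj⟩ : ∃ j, (Set.range fun a => wordFactor x a (j + 1)).ncard ≤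
      (Set.range fun a => wordFactor x a j).ncard := by
    by_contra! hlt
    have (j : ℕ) : j + 1 ≤ (Set.range fun a => wordFactor x a j).ncard := by
      induction j with
      | zero => exact (Set.ncard_pos (hfin 0)).2 (Set.range_nonempty _)
      | succ j ih => exact ih.trans_lt (hlt j)
    have := this n
    omega
  have hinj : Set.InjOn (List.take j) (Set.range fun a => wordFactor x a (j + 1)) := by
    refine Set.injOn_of_ncard_image_eq ?_ (hfin _)
    exact le_antisymm (Set.ncard_image_le (hfin _)) (by rwa [himage])
  have hstep (a b : ℕ) (h : wordFactor x a j = wordFactor x b j) :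
      x (a + j) = x (b + j) ∧ wordFactor x (a + 1) j = wordFactor x (b + 1) j := by
    have h1 : wordFactor x a (j + 1) = wordFactor x b (j + 1) :=
      hinj ⟨a, rfl⟩ ⟨b, rfl⟩ (by rw [htake, htake, h])
    constructor
    · rw [wordFactor_add, wordFactor_add, h] at h1
      simpa [wordFactor] using h1
    · rw [add_comm j 1, wordFactor_add, wordFactor_add] at h1
      exact (List.append_inj h1 (by simp [length_wordFactor])).2
  have hfin' : Finite (Set.range fun a => wordFactor x a j) := hfin j
  obtain ⟨a, b, hab, h⟩ := Finite.exists_ne_map_eq_of_infinite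
    (Set.rangeFactorization fun a => wordFactor x a j)
  have h : wordFactor x a j = wordFactor x b j := congrArg Subtype.val h
  wlog hlt : a < b generalizing a b
  · exact this b a hab.symm (Subtype.ext h.symm) h.symm (by omega)
  have hall (i : ℕ) : wordFactor x (a + i) j = wordFactor x (b + i) j := by
    induction i with
    | zero => exact h
    | succ i ih => exact (hstep _ _ ih).2
  refine ⟨a + j, b - a, by omega, fun i => ?_⟩
  have := (hstep _ _ (hall i)).1
  rw [show a + j + (b - a) + i = b + i + j by omega, ← this]
  congr 1
  omega

theorem List.Lex.append_of_length_eq {α : Type*} {r : α → α → Prop} {s t : List α}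
    (h : List.Lex r s t) (hl : s.length = t.length) (u : List α) :
    List.Lex r (s ++ u) (t ++ u) := by
  induction h with
  | nil => simp at hl
  | cons _ ih => exact .cons (ih (by simpa using hl))
  | rel h => exact .rel h

theorem List.Shortlex.append_both {α : Type*} {r : α → α → Prop} {s t : List α}
    (h : List.Shortlex r s t) (a b : List α) : List.Shortlex r (a ++ s ++ b) (a ++ t ++ b) := by
  have h' := h.append_left a
  rcases List.shortlex_def.1 h' with h1 | ⟨h1, h2⟩
  · exact .of_length_lt (by simpa using h1)
  · exact .of_lex (by rw [List.length_append, h1, ← List.length_append])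
      (h2.append_of_length_eq h1 b)

section Words

variable {k D : Type*} [Field k] [Ring D] [Algebra k D] {m : ℕ} (s : Fin m → D)

/-- The value of a word in the letters `s i`. -/
def wordEval (w : List (Fin m)) : D := (w.map s).prod

theorem wordEval_append (v w : List (Fin m)) :
    wordEval s (v ++ w) = wordEval s v * wordEval s w := by
  simp [wordEval]

variable (k) in
/-- A word is normal if its value is not a combination of values of smaller words. -/
def IsNormalWord (w : List (Fin m)) : Prop :=
  wordEval s w ∉ Submodule.span k (wordEval s '' {v | List.Shortlex (· < ·) v w})

theorem IsNormalWord.of_append {a v b : List (Fin m)} (h : IsNormalWord k s (a ++ v ++ b)) :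
    IsNormalWord k s v := by
  intro hv
  apply h
  let f : D →ₗ[k] D := LinearMap.mulLeft k (wordEval s a) ∘ₗ LinearMap.mulRight k (wordEval s b)
  have h1 := Submodule.mem_map_of_mem (f := f) hv
  rw [Submodule.map_span] at h1
  have e : wordEval s (a ++ v ++ b) = f (wordEval s v) := by
    simp [f, wordEval_append]
  rw [e]
  refine Submodule.span_mono ?_ h1
  rintro _ ⟨_, ⟨u, hu, rfl⟩, rfl⟩
  exact ⟨a ++ u ++ b, List.Shortlex.append_both hu a b, by simp [f, wordEval_append]⟩

theorem linearIndependent_normalWords :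
    LinearIndependent k (fun w : {w // IsNormalWord k s w} => wordEval s w) := by
  rw [linearIndependent_iff']
  by_contra! hne
  classical
  obtain ⟨t, g, hg, i, hit, hi⟩ := hne
  let key (w : {w // IsNormalWord k s w}) : ℕ ×ₗ List (Fin m) := toLex (w.1.length, w.1)
  obtain ⟨w, hw, hmax⟩ := (t.filter fun w => g w ≠ 0).exists_max_image key
    ⟨i, by simp [hit, hi]⟩
  rw [Finset.mem_filter] at hw
  apply w.2
  have hsum := Finset.add_sum_erase t (fun w => g w • wordEval s w) hw.1
  rw [hg] at hsum
  have hw' : wordEval s w = -(g w)⁻¹ • ∑ v ∈ t.erase w, g v • wordEval s v := by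
    rw [eq_neg_of_add_eq_zero_right hsum, smul_neg, neg_smul, neg_neg, inv_smul_smul₀ hw.2]
  rw [hw']
  refine Submodule.smul_mem _ _ (Submodule.sum_mem _ fun v hv => ?_)
  rw [Finset.mem_erase] at hv
  by_cases hgv : g v = 0
  · simp [hgv]
  refine Submodule.smul_mem _ _ (Submodule.subset_span ⟨v, ?_, rfl⟩)
  have hle := hmax v (by simp [hv.2, hgv])
  have hlt : key v < key w := lt_of_le_of_ne hle fun h => hv.1 <| Subtype.ext <|
    congrArg (fun p => (ofLex p).2) h
  rcases (Prod.Lex.lt_iff).1 hlt with h | ⟨h, h'⟩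
  · exact .of_length_lt h
  · exact .of_lex h h'

theorem wordEval_mem_span_normal (w : List (Fin m)) :
    wordEval s w ∈ Submodule.span k (wordEval s '' {w | IsNormalWord k s w}) := by
  induction w using (List.Shortlex.wf (wellFounded_lt (α := Fin m))).induction with
  | _ w ih =>
    by_cases hw : IsNormalWord k s w
    · exact Submodule.subset_span ⟨w, hw, rfl⟩
    · refine Submodule.span_le.2 ?_ (not_not.1 hw)
      rintro _ ⟨v, hv, rfl⟩
      exact ih v hv

theorem span_normalWords (hs : Algebra.adjoin k (Set.range s) = ⊤) :
    Submodule.span k (wordEval s '' {w | IsNormalWord k s w}) = ⊤ := by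
  rw [eq_top_iff, ← Algebra.top_toSubmodule, ← hs, Algebra.adjoin_eq_span, Submodule.span_le]
  intro x hx
  obtain ⟨w, rfl⟩ : ∃ w, wordEval s w = x := by
    induction hx using Submonoid.closure_induction with
    | mem x hx =>
      obtain ⟨i, rfl⟩ := hx
      exact ⟨[i], by simp [wordEval]⟩
    | one => exact ⟨[], rfl⟩
    | mul x y _ _ hx hy =>
      obtain ⟨⟨v, rfl⟩, w, rfl⟩ := And.intro hx hy
      exact ⟨v ++ w, wordEval_append s v w⟩
  exact wordEval_mem_span_normal s w

theorem wordEval_mem_pow (w : List (Fin m)) {n : ℕ} (hw : w.length ≤ n) :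
    wordEval s w ∈ (Submodule.span k (Set.range s) ⊔ 1) ^ n := by
  induction n generalizing w with
  | zero =>
    obtain rfl : w = [] := List.length_eq_zero_iff.1 (by omega)
    exact Submodule.one_le.1 le_rfl
  | succ n ih =>
    rw [pow_succ']
    cases w with
    | nil =>
      have := Submodule.mul_mem_mul (Submodule.mem_sup_right (S := Submodule.span k (Set.range s))
        (Submodule.one_le.1 le_rfl : (1 : D) ∈ (1 : Submodule k D))) (ih [] (Nat.zero_le n))
      simpa [wordEval] using this
    | cons a w =>
      have := Submodule.mul_mem_mul (Submodule.mem_sup_left (T := (1 : Submodule k D))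
        (Submodule.subset_span (R := k) (Set.mem_range_self (f := s) a)))
        (ih w (by simpa using hw))
      simpa [wordEval] using this

theorem exists_normalWord_of_length (hs : Algebra.adjoin k (Set.range s) = ⊤)
    (hinf : ¬ Module.Finite k D) (n : ℕ) : ∃ w, w.length = n ∧ IsNormalWord k s w := by
  by_contra! h
  apply hinf
  have hfin : {w | IsNormalWord k s w}.Finite := by
    refine (List.finite_length_lt (Fin m) n).subset fun w hw => ?_
    by_contra! hlen
    have hw' : IsNormalWord k s ([] ++ w.take n ++ w.drop n) := by simpa using hw
    exact h (w.take n) (by simpa using hlen) (hw'.of_append s)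
  exact ⟨(hfin.image _).toFinset, by simpa using span_normalWords s hs⟩

theorem exists_infinite_normalWord (hs : Algebra.adjoin k (Set.range s) = ⊤)
    (hinf : ¬ Module.Finite k D) : ∃ x : ℕ → Fin m, ∀ a n, IsNormalWord k s (wordFactor x a n) := by
  let E (w : List (Fin m)) : Prop := ∀ n, ∃ v : List (Fin m), v.length = n ∧
    IsNormalWord k s (w ++ v)
  have hstep (w : {w // E w}) : ∃ a, E (w.1 ++ [a]) := by
    by_contra! h
    simp only [E, not_forall] at h
    choose f hf using h
    obtain ⟨v, hv, hnv⟩ := w.2 (Finset.univ.sup f + 1)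
    obtain ⟨a, v, rfl⟩ := List.exists_cons_of_length_eq_add_one hv
    refine hf a ⟨v.take (f a), ?_, ?_⟩
    · have : f a ≤ Finset.univ.sup f := Finset.le_sup (Finset.mem_univ a)
      simp at hv
      simp [hv, this]
    · have : IsNormalWord k s ([] ++ (w.1 ++ [a] ++ v.take (f a)) ++ v.drop (f a)) := by
        simpa using hnv
      exact this.of_append s
  choose g hg using hstep
  have hE : E [] := fun n => by
    obtain ⟨v, hv⟩ := exists_normalWord_of_length (k := k) s hs hinf n
    exact ⟨v, hv⟩
  let W (n : ℕ) : {w // E w} := Nat.rec ⟨[], hE⟩ (fun _ w => ⟨w.1 ++ [g w], hg w⟩) n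
  let x (n : ℕ) : Fin m := g (W n)
  have hW (n : ℕ) : wordFactor x 0 n = (W n).1 := by
    induction n with
    | zero => rfl
    | succ n ih =>
      rw [wordFactor_add, ih]
      simp [wordFactor, x, W]
  refine ⟨x, fun a n => ?_⟩
  obtain ⟨v, -, hv⟩ := (W (a + n)).2 0
  rw [← hW, wordFactor_add, zero_add] at hv
  exact hv.of_append s

theorem sum_ncard_normalWords_le (n : ℕ) :
    ∑ j ∈ Finset.range (n + 1), {w | w.length = j ∧ IsNormalWord k s w}.ncard ≤
      Module.finrank k ((Submodule.span k (Set.range s) ⊔ 1) ^ n : Submodule k D) := by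
  have hfin (j : ℕ) : {w | w.length = j ∧ IsNormalWord k s w}.Finite :=
    (List.finite_length_eq (Fin m) j).subset fun w hw => hw.1
  have hfin' : {w : List (Fin m) | w.length ≤ n ∧ IsNormalWord k s w}.Finite :=
    (List.finite_length_le (Fin m) n).subset fun w hw => hw.1
  let V : Submodule k D := (Submodule.span k (Set.range s) ⊔ 1) ^ n
  have hV : Module.Finite k V := by
    have h1 : (Submodule.span k (Set.range s) ⊔ 1 : Submodule k D).FG :=
      (Submodule.fg_span (Set.finite_range s)).sup
        (by rw [Submodule.one_eq_span]; exact Submodule.fg_span_singleton 1)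
    exact Module.Finite.iff_fg.2 (h1.pow n)
  have := hfin'.fintype
  have hli : LinearIndependent k (fun w : {w : List (Fin m) | w.length ≤ n ∧ IsNormalWord k s w} =>
      (⟨wordEval s w, wordEval_mem_pow s w.1 w.2.1⟩ : V)) := by
    have h := (linearIndependent_normalWords (k := k) s).comp
      (fun w : {w : List (Fin m) | w.length ≤ n ∧ IsNormalWord k s w} => ⟨w.1, w.2.2⟩)
      (fun v w h => Subtype.ext (congrArg (fun u => u.1) h))
    exact LinearIndependent.of_comp V.subtype h
  refine le_trans (le_of_eq ?_) hli.fintype_card_le_finrank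
  rw [← Nat.card_eq_fintype_card, Nat.card_coe_set_eq, Set.ncard_eq_toFinset_card _ hfin',
    Finset.card_eq_sum_card_fiberwise (f := List.length) (t := Finset.range (n + 1))]
  · refine Finset.sum_congr rfl fun j hj => ?_
    rw [← Set.ncard_coe_finset]
    congr 1
    ext w
    simp at hj ⊢
    grind
  · intro w hw
    simp at hw ⊢
    omega

/-- An infinite-dimensional finitely generated algebra of GK-dimension less than two has an
element with linearly independent powers. -/
theorem exists_linearIndependent_pow (hs : Algebra.adjoin k (Set.range s) = ⊤)
    (hinf : ¬ Module.Finite k D) (C : ℝ)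
    (hC : ∀ n : ℕ, (Module.finrank k ((Submodule.span k (Set.range s) ⊔ 1) ^ n : Submodule k D) : ℝ)
      ≤ C * ((n : ℝ) + 1) ^ (3 / 2 : ℝ)) :
    ∃ t : D, LinearIndependent k (fun n : ℕ => t ^ n) := by
  obtain ⟨n, hn⟩ : ∃ n, {w | w.length = n ∧ IsNormalWord k s w}.ncard ≤ n := by
    by_contra! h
    obtain ⟨n, hn⟩ := exists_mul_rpow_lt_sq C
    have h1 : (n + 1) ^ 2 ≤ ∑ j ∈ Finset.range (2 * n + 1),
        {w | w.length = j ∧ IsNormalWord k s w}.ncard := by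
      calc (n + 1) ^ 2 ≤ ∑ j ∈ Finset.range (2 * n + 1), (j + 1) := by
            rw [Finset.sum_add_distrib, Finset.sum_range_id, Finset.sum_const, Finset.card_range]
            have : (2 * n + 1) * (2 * n + 1 - 1) / 2 = (2 * n + 1) * n := by
              rw [Nat.add_sub_cancel, mul_left_comm, Nat.mul_div_cancel_left _ two_pos]
            rw [this, smul_eq_mul]
            nlinarith
        _ ≤ _ := Finset.sum_le_sum fun j _ => h j
    have h2 := h1.trans (sum_ncard_normalWords_le (k := k) s (2 * n))
    have h3 : ((n : ℝ) + 1) ^ 2 ≤ (Module.finrank k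
      ((Submodule.span k (Set.range s) ⊔ 1) ^ (2 * n) : Submodule k D) : ℝ) := by exact_mod_cast h2
    exact absurd (h3.trans (hC (2 * n))) (not_le.2 hn)
  obtain ⟨x, hx⟩ := exists_infinite_normalWord (k := k) s hs hinf
  obtain ⟨c, q, hq, hcq⟩ := exists_period_of_ncard_factors_le x n <| by
    refine le_trans (Set.ncard_le_ncard ?_
      ((List.finite_length_eq (Fin m) n).subset fun w hw => hw.1)) hn
    rintro _ ⟨a, rfl⟩
    exact ⟨length_wordFactor x a n, hx a n⟩
  have hpow (N : ℕ) : wordEval s (wordFactor x c q) ^ N = wordEval s (wordFactor x c (N * q)) := by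
    induction N with
    | zero => simp [wordEval, wordFactor]
    | succ N ih =>
      rw [pow_succ', ih, add_mul, one_mul, add_comm, wordFactor_add, wordEval_append]
      congr 2
      simp only [wordFactor, hcq]
  refine ⟨wordEval s (wordFactor x c q), ?_⟩
  have := (linearIndependent_normalWords (k := k) s).comp
    (fun N : ℕ => ⟨wordFactor x c (N * q), hx _ _⟩) fun M N h => by
      have := congrArg (fun w => w.1.length) h
      simp only [length_wordFactor] at this
      exact Nat.eq_of_mul_eq_mul_right hq this
  convert this using 2 with N
  exact hpow N

end Words

section OrbitGrowth

variable {k R M : Type*} [Field k] [Ring R] [Algebra k R] [AddCommGroup M] [Module R M]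
  [Module k M] [IsScalarTower k R M]

variable (k R) in
/-- The orbit map `r ↦ r • x`. -/
def orbitMap (x : M) : R →ₗ[k] M := (LinearMap.toSpanSingleton R M x).restrictScalars k

@[simp]
theorem orbitMap_apply (x : M) (r : R) : orbitMap k R x r = r • x := rfl

variable (k R M) in
/-- Every finitely generated piece of `M` grows at most like `n ^ (3 / 2)`. -/
def SubquadraticGrowth : Prop :=
  ∀ (W : Submodule k R), Module.Finite k W → ∀ x : M, ∃ C : ℝ, ∀ n : ℕ,
    (Module.finrank k (((W ⊔ 1) ^ n : Submodule k R).map (orbitMap k R x)) : ℝ)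
      ≤ C * ((n : ℝ) + 1) ^ (3 / 2 : ℝ)

theorem finite_sup_one_pow (W : Submodule k R) [Module.Finite k W] (n : ℕ) :
    Module.Finite k ((W ⊔ 1) ^ n : Submodule k R) :=
  Module.Finite.iff_fg.2 (((Module.Finite.iff_fg.1 ‹_›).sup
    (by rw [Submodule.one_eq_span]; exact Submodule.fg_span_singleton 1)).pow n)

theorem finrank_pow_le_finrank_map_orbitMap {D : Type*} [DivisionRing D] [Algebra k D] [Module D M]
    [IsScalarTower k D M] [SMulCommClass R D M] {x : M} (hx : x ≠ 0) {m : ℕ} (s : Fin m → D)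
    (a : Fin m → R) (h : ∀ i, s i • x = a i • x) (n : ℕ) :
    Module.finrank k ((Submodule.span k (Set.range s) ⊔ 1) ^ n : Submodule k D) ≤
      Module.finrank k (((Submodule.span k (Set.range a) ⊔ 1) ^ n : Submodule k R).map
        (orbitMap k R x)) := by
  have h1 (d : D) (hd : d ∈ Submodule.span k (Set.range s) ⊔ 1) :
      d • x ∈ (Submodule.span k (Set.range a) ⊔ 1 : Submodule k R).map (orbitMap k R x) := by
    suffices H : Submodule.span k (Set.range s) ⊔ 1 ≤
        ((Submodule.span k (Set.range a) ⊔ 1 : Submodule k R).map (orbitMap k R x)).comap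
          (orbitMap k D x) from H hd
    refine sup_le (Submodule.span_le.2 ?_) (Submodule.one_le.2 ?_)
    · rintro _ ⟨i, rfl⟩
      exact ⟨a i, Submodule.mem_sup_left (Submodule.subset_span ⟨i, rfl⟩), (h i).symm⟩
    · exact ⟨1, Submodule.mem_sup_right (Submodule.one_le.1 le_rfl), by simp⟩
  have h2 : ((Submodule.span k (Set.range s) ⊔ 1) ^ n : Submodule k D).map (orbitMap k D x) ≤
      ((Submodule.span k (Set.range a) ⊔ 1) ^ n : Submodule k R).map (orbitMap k R x) := by
    rw [Submodule.map_le_iff_le_comap]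
    induction n with
    | zero =>
      rw [pow_zero, pow_zero, Submodule.one_le]
      exact ⟨1, Submodule.one_le.1 le_rfl, by simp⟩
    | succ n ih =>
      rw [pow_succ, pow_succ', Submodule.mul_le]
      intro d hd e he
      obtain ⟨v, hv, hv'⟩ := ih hd
      obtain ⟨w, hw, hw'⟩ := h1 e he
      refine ⟨w * v, Submodule.mul_mem_mul hw hv, ?_⟩
      rw [orbitMap_apply] at hv' hw' ⊢
      rw [mul_smul, hv', orbitMap_apply, orbitMap_apply, mul_smul, ← hw', smul_comm]
  have : Module.Finite k (Submodule.span k (Set.range a)) :=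
    Module.Finite.span_of_finite k (Set.finite_range a)
  have := finite_sup_one_pow (Submodule.span k (Set.range a)) n
  refine le_trans (le_of_eq ?_) (Submodule.finrank_mono h2)
  exact (Submodule.equivMapOfInjective (orbitMap k D x)
    (smul_left_injective D hx) _).finrank_eq


/-- A division algebra commuting with a finitely generated algebra and acting on a simple module
with finite dimension is a finitely generated algebra. -/
theorem exists_adjoin_eq_top_of_isSimpleModule [IsSimpleModule R M] [Algebra.FiniteType k R]
    (D : Type*) [DivisionRing D] [Algebra k D] [Module D M] [IsScalarTower k D M]
    [SMulCommClass R D M] [Module.Finite D M] :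
    ∃ (m : ℕ) (s : Fin m → D), Algebra.adjoin k (Set.range s) = ⊤ := by
  obtain ⟨S, hS⟩ := Algebra.FiniteType.out (R := k) (A := R)
  let b := Module.finBasis D M
  let ι := Fin (Module.finrank D M)
  let c : S × ι × ι → D := fun p => b.repr ((p.1 : R) • b p.2.1) p.2.2
  let D₀ := Algebra.adjoin k (Set.range c)
  have hgen (r : R) (hr : r ∈ S) (i j : ι) : b.repr (r • b i) j ∈ D₀ :=
    Algebra.subset_adjoin ⟨(⟨r, hr⟩, i, j), rfl⟩
  have hstab (r : R) : ∀ m : M, (∀ j, b.repr m j ∈ D₀) → ∀ j, b.repr (r • m) j ∈ D₀ := by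
    have hr : r ∈ Algebra.adjoin k (S : Set R) := hS ▸ Algebra.mem_top
    induction hr using Algebra.adjoin_induction with
    | mem r hr =>
      intro m hm j
      have : r • m = ∑ i, b.repr m i • r • b i := by
        conv_lhs => rw [← b.sum_repr m]
        rw [Finset.smul_sum]
        exact Finset.sum_congr rfl fun i _ => smul_comm _ _ _
      rw [this, map_sum, Finsupp.finsetSum_apply]
      refine sum_mem fun i _ => ?_
      rw [map_smul, Finsupp.smul_apply, smul_eq_mul]
      exact mul_mem (hm i) (hgen r hr i j)
    | algebraMap a =>
      intro m hm j
      rw [algebraMap_smul, ← algebraMap_smul D a m, map_smul, Finsupp.smul_apply, smul_eq_mul]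
      exact mul_mem (D₀.algebraMap_mem a) (hm j)
    | add x y _ _ hx hy =>
      intro m hm j
      rw [add_smul, map_add, Finsupp.add_apply]
      exact add_mem (hx m hm j) (hy m hm j)
    | mul x y _ _ hx hy =>
      intro m hm j
      rw [mul_smul]
      exact hx _ (hy m hm) j
  let L : Submodule R M :=
    { carrier := {m | ∀ j, b.repr m j ∈ D₀}
      add_mem' := fun {x y} hx hy j => by
        rw [map_add, Finsupp.add_apply]
        exact add_mem (hx j) (hy j)
      zero_mem' := fun j => by simp
      smul_mem' := fun r m hm => hstab r m hm }
  have := IsSimpleModule.nontrivial R M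
  obtain ⟨i⟩ : Nonempty ι := b.index_nonempty
  have hbi : b i ∈ L := fun j => by
    rw [b.repr_self, Finsupp.single_apply]
    split_ifs
    exacts [one_mem _, zero_mem _]
  have hL : L = ⊤ := (eq_bot_or_eq_top L).resolve_left fun h =>
    b.ne_zero i ((Submodule.mem_bot R).1 (h ▸ hbi))
  have htop : D₀ = ⊤ := by
    refine eq_top_iff.2 fun d _ => ?_
    have : d • b i ∈ L := hL ▸ Submodule.mem_top
    simpa using this i
  let e := Fintype.equivFin (S × ι × ι)
  refine ⟨_, c ∘ e.symm, ?_⟩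
  rwa [Set.range_comp, e.symm.surjective.range_eq, Set.image_univ]

/-- A simple module of subquadratic growth is finite-dimensional over every commuting field
containing an element with linearly independent powers. -/
theorem finite_of_linearIndependent_pow [IsSimpleModule R M] [Algebra.FiniteType k R]
    (hgr : SubquadraticGrowth k R M)
    (K : Type*) [Field K] [Algebra k K] [Module K M] [IsScalarTower k K M] [SMulCommClass R K M]
    (t : K) (ht : LinearIndependent k fun n : ℕ => t ^ n) : Module.Finite K M := by
  obtain ⟨S, hS⟩ := Algebra.FiniteType.out (R := k) (A := R)
  have := IsSimpleModule.nontrivial R M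
  obtain ⟨x, hx⟩ := exists_ne (0 : M)
  obtain ⟨a, ha⟩ := IsSimpleModule.toSpanSingleton_surjective R hx (t • x)
  rw [LinearMap.toSpanSingleton_apply] at ha
  let W : Submodule k R := Submodule.span k (insert a (S : Set R))
  have hW : Module.Finite k W := Module.Finite.span_of_finite k (S.finite_toSet.insert a)
  let P (n : ℕ) : Submodule k M := ((W ⊔ 1) ^ n : Submodule k R).map (orbitMap k R x)
  have hPfin (n : ℕ) : Module.Finite k (P n) := by
    have := finite_sup_one_pow W n
    exact Module.Finite.map _ _
  let U (n : ℕ) : Submodule K M := Submodule.span K (P n)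
  have hPU (n : ℕ) : (U n).restrictScalars k ≥ P n := Submodule.subset_span
  have hmono (n : ℕ) : P n ≤ P (n + 1) := by
    refine Submodule.map_mono ?_
    rw [pow_succ]
    exact le_mul_of_one_le_right' le_sup_right
  have hUmono (n : ℕ) : U n ≤ U (n + 1) := Submodule.span_mono (hmono n)
  have hUfin (n : ℕ) : Module.Finite K (U n) := by
    obtain ⟨s, hs⟩ := Module.Finite.iff_fg.1 (hPfin n)
    have : U n = Submodule.span K (s : Set M) := by
      rw [← Submodule.span_span_of_tower k K, hs]
    rw [this]
    infer_instance
  have hstep (n : ℕ) (r : R) (hr : r ∈ W ⊔ 1) (m : M) (hm : m ∈ U n) : r • m ∈ U (n + 1) := by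
    induction hm using Submodule.span_induction with
    | mem m hm =>
      obtain ⟨w, hw, rfl⟩ := hm
      refine Submodule.subset_span ⟨r * w, ?_, mul_smul r w x⟩
      rw [pow_succ']
      exact Submodule.mul_mem_mul hr hw
    | zero => simp
    | add x y _ _ hx hy => rw [smul_add]; exact add_mem hx hy
    | smul c y _ hy => rw [smul_comm]; exact Submodule.smul_mem _ c hy
  by_contra hinf
  have hlt (n : ℕ) : U n < U (n + 1) := by
    refine lt_of_le_of_ne (hUmono n) fun heq => hinf ?_
    have hstab (r : R) : ∀ m ∈ U n, r • m ∈ U n := by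
      have hr : r ∈ Algebra.adjoin k (S : Set R) := hS ▸ Algebra.mem_top
      induction hr using Algebra.adjoin_induction with
      | mem r hr =>
        intro m hm
        rw [heq]
        exact hstep n r (Submodule.mem_sup_left (Submodule.subset_span (Or.inr hr))) m hm
      | algebraMap a =>
        intro m hm
        rw [algebraMap_smul, ← algebraMap_smul K a m]
        exact Submodule.smul_mem _ _ hm
      | add x y _ _ hx hy =>
        intro m hm
        rw [add_smul]
        exact add_mem (hx m hm) (hy m hm)
      | mul x y _ _ hx hy =>
        intro m hm
        rw [mul_smul]
        exact hx _ (hy m hm)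
    have hxU : x ∈ U n := by
      refine hPU n ⟨1, ?_, one_smul R x⟩
      exact Submodule.one_le.1 (one_le_pow_of_one_le' le_sup_right n)
    have : U n = ⊤ := by
      refine eq_top_iff.2 fun m _ => ?_
      obtain ⟨r, rfl⟩ := IsSimpleModule.toSpanSingleton_surjective R hx m
      exact hstab r x hxU
    have h := hUfin n
    rw [this] at h
    exact ⟨Module.Finite.iff_fg.1 h⟩
  have hrank (n : ℕ) : n + 1 ≤ Module.finrank K (U n) := by
    induction n with
    | zero =>
      refine Nat.one_le_iff_ne_zero.2 fun h => hx ?_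
      have hxU : x ∈ U 0 := hPU 0 ⟨1, by rw [pow_zero]; exact Submodule.one_le.1 le_rfl,
        one_smul R x⟩
      rw [Submodule.finrank_eq_zero] at h
      simpa [h] using hxU
    | succ n ih => exact ih.trans_lt (Submodule.finrank_lt_finrank_of_lt (hlt n))
  have htpow (n i : ℕ) (hi : i ≤ n) (m : M) (hm : m ∈ P n) : t ^ i • m ∈ P (2 * n) := by
    have hta : t ^ i • x = a ^ i • x := by
      clear hi
      induction i with
      | zero => simp
      | succ i ih => rw [pow_succ', mul_smul, ih, ← smul_comm, ← ha, ← mul_smul, pow_succ]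
    obtain ⟨w, hw, rfl⟩ := hm
    refine ⟨w * a ^ i, ?_, ?_⟩
    · rw [two_mul, pow_add]
      refine Submodule.mul_mem_mul hw (pow_le_pow_right' (le_sup_right : 1 ≤ W ⊔ 1) hi ?_)
      exact Submodule.pow_mem_pow _ (Submodule.mem_sup_left
        (Submodule.subset_span (Set.mem_insert a _))) i
    · simp only [orbitMap_apply]
      rw [mul_smul, ← hta, smul_comm]
  have hbig (n : ℕ) : (n + 1) ^ 2 ≤ Module.finrank k (P (2 * n)) := by
    obtain ⟨B, hBP, hBs, hBl⟩ := exists_linearIndependent K (P n : Set M)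
    have hBU : B ⊆ (U n : Set M) := hBP.trans Submodule.subset_span
    have hBfin : B.Finite := by
      have h := hUfin n
      have hl : LinearIndependent K (fun b : B => (⟨b, hBU b.2⟩ : U n)) :=
        LinearIndependent.of_comp (U n).subtype hBl
      exact @Set.toFinite _ B hl.finite
    have hBc : n + 1 ≤ Nat.card B := by
      have := hBfin.to_subtype
      have := Fintype.ofFinite B
      have h := hrank n
      rw [Nat.card_eq_fintype_card]
      refine h.trans ?_
      have e : U n = Submodule.span K (Set.range ((↑) : B → M)) := by
        rw [Subtype.range_coe]; exact hBs.symm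
      rw [e]
      exact finrank_range_le_card _
    have := hBfin.to_subtype
    have := Fintype.ofFinite B
    have hl := linearIndependent_smul
      (ht.comp (fun i : Fin (n + 1) => (i : ℕ)) Fin.val_injective) hBl
    have hl' : LinearIndependent k fun p : Fin (n + 1) × B =>
        (⟨t ^ (p.1 : ℕ) • (p.2 : M), htpow n p.1 (by omega) _ (hBP p.2.2)⟩ : P (2 * n)) :=
      LinearIndependent.of_comp (P (2 * n)).subtype hl
    have := hPfin (2 * n)
    have h := hl'.fintype_card_le_finrank
    rw [Fintype.card_prod, Fintype.card_fin, ← Nat.card_eq_fintype_card (α := B)] at h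
    nlinarith
  obtain ⟨C, hC⟩ := hgr W hW x
  obtain ⟨n, hn⟩ := exists_mul_rpow_lt_sq C
  have h3 : ((n : ℝ) + 1) ^ 2 ≤ (Module.finrank k (P (2 * n)) : ℝ) := by exact_mod_cast hbig n
  exact absurd (h3.trans (hC (2 * n))) (not_le.2 hn)
end OrbitGrowth

section Specialization

open Polynomial

variable {k R : Type*} [Field k] [Ring R] [Algebra k R]

theorem finite_quotient_ker {E : Type*} [Ring E] [Algebra k E] [Module.Finite k E]
    (τ : R →ₐ[k] E) : Module.Finite k (R ⧸ RingHom.ker τ) := by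
  have h : Module.Finite k (R ⧸ (RingHom.ker τ).restrictScalars k) :=
    Module.Finite.equiv (M := LinearMap.range τ.toLinearMap) τ.toLinearMap.quotKerEquivRange.symm
  exact Module.Finite.equiv (Submodule.Quotient.restrictScalarsEquiv k (RingHom.ker τ))

/-- Matrix representations over the rational function field of a finitely generated algebra
specialize to nonzero finite-dimensional representations. -/
theorem exists_ideal_of_matrix_fractionRing [Algebra.FiniteType k R] {m : Type*} [Fintype m]
    [DecidableEq m] [Nonempty m] (σ : R →ₐ[k] Matrix m m (FractionRing k[X])) :
    ∃ J : Ideal R, J ≠ ⊤ ∧ RingHom.ker σ ≤ J ∧ Module.Finite k (R ⧸ J) := by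
  classical
  obtain ⟨S, hS⟩ := Algebra.FiniteType.out (R := k) (A := R)
  obtain ⟨f, hf⟩ := IsLocalization.exist_integer_multiples (nonZeroDivisors k[X])
    (S ×ˢ (Finset.univ : Finset (m × m)))
    (fun p : R × m × m => σ p.1 p.2.1 p.2.2)
  have hf0 : (f : k[X]) ≠ 0 := nonZeroDivisors.ne_zero f.2
  have hfK : algebraMap k[X] (FractionRing k[X]) f ≠ 0 := by
    rwa [Ne, IsFractionRing.to_map_eq_zero_iff]
  let O := Localization.Away (f : k[X])
  let ι : O →ₐ[k] FractionRing k[X] := IsLocalization.Away.liftAlgHom (f : k[X])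
    (f := IsScalarTower.toAlgHom k k[X] (FractionRing k[X])) (IsUnit.mk0 _ hfK)
  have hιa (p : k[X]) : ι (algebraMap _ _ p) = algebraMap _ _ p := by
    exact IsLocalization.Away.lift_eq (f : k[X]) (g := algebraMap k[X] (FractionRing k[X]))
      (IsUnit.mk0 _ hfK) p
  have hfO : IsUnit (algebraMap k[X] O f) := IsLocalization.Away.algebraMap_isUnit _
  have hι : Function.Injective ι := by
    refine (injective_iff_map_eq_zero ι).2 fun o ho => ?_
    obtain ⟨⟨a, s⟩, has⟩ := IsLocalization.surj (Submonoid.powers (f : k[X])) o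
    have h := congrArg ι has
    rw [map_mul, ho, zero_mul, hιa, eq_comm, IsFractionRing.to_map_eq_zero_iff] at h
    change o * algebraMap k[X] O s = algebraMap k[X] O a at has
    change a = 0 at h
    rw [h, map_zero] at has
    exact ((IsLocalization.map_units O s).mul_left_eq_zero).1 has
  have hσ (r : R) : σ r ∈ (ι.mapMatrix (m := m)).range := by
    have hr : r ∈ Algebra.adjoin k (S : Set R) := hS ▸ Algebra.mem_top
    suffices H : Algebra.adjoin k (S : Set R) ≤ (ι.mapMatrix (m := m)).range.comap σ from H hr
    refine Algebra.adjoin_le fun r hr => ?_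
    choose p hp using fun ij : m × m => hf (r, ij) (by simpa using hr)
    refine ⟨fun i j => (hfO.unit⁻¹ : Oˣ) * algebraMap k[X] O (p (i, j)), ?_⟩
    ext i j
    have hu : ι (hfO.unit⁻¹ : Oˣ) * algebraMap k[X] (FractionRing k[X]) f = 1 := by
      rw [← hιa, ← map_mul, IsUnit.val_inv_mul, map_one]
    have h : _ = (f : k[X]) • σ r i j := hp (i, j)
    rw [Algebra.smul_def] at h
    change ι (_ * _) = _
    rw [map_mul, hιa, h, ← mul_assoc, hu, one_mul]
    rfl
  let F := AdjoinRoot (1 + X * (f : k[X]))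
  have hdeg : (1 + X * (f : k[X])).natDegree ≠ 0 := by
    rw [natDegree_add_eq_right_of_natDegree_lt] <;> simp [hf0]
  have hg0 : (1 + X * (f : k[X])) ≠ 0 := fun h => hdeg (by simp [h])
  have : Nontrivial F := AdjoinRoot.nontrivial _ fun h => 
    hdeg (natDegree_eq_of_degree_eq_some h)
  have : Module.Finite k F := (AdjoinRoot.powerBasis hg0).finite
  have hfF : IsUnit (AdjoinRoot.mkₐ (1 + X * (f : k[X])) f) := by
    refine IsUnit.of_mul_eq_one (-AdjoinRoot.mk _ X) ?_
    have h := AdjoinRoot.mk_self (f := 1 + X * (f : k[X]))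
    rw [map_add, map_mul, map_one] at h
    rw [AdjoinRoot.coe_mkₐ]
    linear_combination -h
  let ε : O →ₐ[k] F := IsLocalization.Away.liftAlgHom (f : k[X]) hfF
  let τ : R →ₐ[k] Matrix m m F := ε.mapMatrix.comp
    (((AlgEquiv.ofInjective (ι.mapMatrix (m := m)) (Matrix.map_injective hι)).symm : _ →ₐ[k] _).comp
      (σ.codRestrict _ hσ))
  refine ⟨RingHom.ker τ, RingHom.ker_ne_top _, fun r hr => ?_, finite_quotient_ker τ⟩
  have h : σ.codRestrict _ hσ r = 0 := Subtype.ext hr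
  simp [τ, h]

end Specialization

section Cofinite

open Polynomial

/-- An element of a division algebra with linearly independent powers generates a copy of the
rational function field. -/
theorem exists_fractionRing_algHom {k D : Type*} [Field k] [DivisionRing D] [Algebra k D] {t : D}
    (ht : LinearIndependent k fun n : ℕ => t ^ n) :
    ∃ φ : FractionRing k[X] →ₐ[k] D, ∀ p : k[X], φ (algebraMap _ _ p) = aeval t p := by
  have hinj (p : k[X]) (hp : aeval t p = 0) : p = 0 := by
    rw [aeval_eq_sum_range] at hp
    exact leadingCoeff_eq_zero.1 (linearIndependent_iff'.1 ht _ _ hp _ (by simp))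
  let u : nonZeroDivisors k[X] →* Dˣ :=
    { toFun := fun s => Units.mk0 (aeval t (s : k[X]))
        fun h => nonZeroDivisors.ne_zero s.2 (hinj _ h)
      map_one' := by ext; simp
      map_mul' := fun a b => by ext; simp }
  let φ : FractionRing k[X] →+* D :=
    OreLocalization.universalHom (aeval t : k[X] →ₐ[k] D).toRingHom u fun _ => rfl
  have hφ (p : k[X]) : φ (algebraMap _ _ p) = aeval t p :=
    OreLocalization.universalHom_commutes _ _ _
  refine ⟨{ φ with commutes' := fun c => ?_ }, hφ⟩
  have := hφ (C c)
  rw [aeval_C] at this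
  exact this

variable {k R M : Type*} [Field k] [Ring R] [Algebra k R] [AddCommGroup M] [Module R M]
  [Module k M] [IsScalarTower k R M]

/-- The annihilator of a simple module of subquadratic growth which is finite-dimensional over its
endomorphism ring lies in a proper left ideal of finite codimension. -/
theorem exists_ideal_of_subquadraticGrowth [IsSimpleModule R M] [Algebra.FiniteType k R]
    [Module.Finite (Module.End R M) M] (hgr : SubquadraticGrowth k R M) :
    ∃ J : Ideal R, J ≠ ⊤ ∧ (∀ r : R, (∀ m : M, r • m = 0) → r ∈ J) ∧
      Module.Finite k (R ⧸ J) := by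
  classical
  have := IsScalarTower.to_smulCommClass' (R := k) (A := R) (M := M)
  have := IsSimpleModule.nontrivial R M
  obtain ⟨x, hx⟩ := exists_ne (0 : M)
  let D := Module.End R M
  let : DivisionRing D := Module.End.instDivisionRing
  have : IsScalarTower k D M := ⟨fun _ _ _ => rfl⟩
  by_cases hfin : Module.Finite k D
  · have : Module.Finite k M := Module.Finite.trans D M
    refine ⟨LinearMap.ker (LinearMap.toSpanSingleton R M x), fun h => hx ?_, fun r hr => hr x, ?_⟩
    · have h1 : (1 : R) ∈ LinearMap.ker (LinearMap.toSpanSingleton R M x) := h ▸ Submodule.mem_top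
      simpa using h1
    · have h : Module.Finite k
          (R ⧸ (LinearMap.ker (LinearMap.toSpanSingleton R M x)).restrictScalars k) :=
        Module.Finite.equiv (M := LinearMap.range (orbitMap k R x))
          (orbitMap k R x).quotKerEquivRange.symm
      exact Module.Finite.equiv (Submodule.Quotient.restrictScalarsEquiv k _)
  · obtain ⟨m, s, hs⟩ := exists_adjoin_eq_top_of_isSimpleModule (k := k) (R := R) (M := M) D
    choose a ha using fun i => IsSimpleModule.toSpanSingleton_surjective R hx (s i • x)
    obtain ⟨C, hC⟩ := hgr (Submodule.span k (Set.range a))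
      (Module.Finite.span_of_finite k (Set.finite_range a)) x
    obtain ⟨t, ht⟩ := exists_linearIndependent_pow (k := k) s hs hfin C fun n =>
      le_trans (Nat.cast_le.2 (finrank_pow_le_finrank_map_orbitMap hx s a
        (fun i => (ha i).symm) n)) (hC n)
    obtain ⟨φ, hφ⟩ := exists_fractionRing_algHom ht
    let K := FractionRing k[X]
    let : Module K M := Module.compHom M φ.toRingHom
    have hsmul (c : K) (m : M) : c • m = φ c m := rfl
    have : IsScalarTower k K M := ⟨fun c y m => by
      rw [hsmul, hsmul, map_smul]
      rfl⟩
    have : SMulCommClass R K M := ⟨fun r y m => by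
      rw [hsmul, hsmul, map_smul]⟩
    have : SMulCommClass K R M := SMulCommClass.symm R K M
    have : Module.Finite K M := finite_of_linearIndependent_pow hgr K
      (algebraMap k[X] K X) <| by
        refine LinearIndependent.of_comp φ.toLinearMap ?_
        convert ht using 2 with n
        change φ _ = _
        rw [map_pow]
        exact congrArg (· ^ n) ((hφ X).trans (aeval_X t))
    let b := Module.finBasis K M
    have : Nonempty (Fin (Module.finrank K M)) := b.index_nonempty
    let σ : R →ₐ[k] Matrix (Fin (Module.finrank K M)) (Fin (Module.finrank K M)) K :=
      (((LinearMap.toMatrixAlgEquiv b).restrictScalars k : _ ≃ₐ[k] _) :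
        _ →ₐ[k] _).comp
        (Algebra.lsmul k K M)
    obtain ⟨J, hJ, hσJ, hJfin⟩ := exists_ideal_of_matrix_fractionRing σ
    refine ⟨J, hJ, fun r hr => hσJ ?_, hJfin⟩
    have : Algebra.lsmul k K M r = 0 := LinearMap.ext hr
    simp [σ, this]

end Cofinite

section Opposite

theorem isNoetherian_op_op (A : Type*) [Ring A] [IsNoetherianRing A] :
    IsNoetherian (Aᵐᵒᵖ)ᵐᵒᵖ Aᵐᵒᵖ := by
  let Φ (N : Submodule (Aᵐᵒᵖ)ᵐᵒᵖ Aᵐᵒᵖ) : Submodule A A :=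
    { carrier := {b | MulOpposite.op b ∈ N}
      add_mem' := fun ha hb => N.add_mem ha hb
      zero_mem' := N.zero_mem
      smul_mem' := fun a _ hb => N.smul_mem (MulOpposite.op (MulOpposite.op a)) hb }
  have hΦ : StrictMono Φ := by
    refine Monotone.strictMono_of_injective (fun N P h b hb => h hb) fun N P h => ?_
    ext b
    exact SetLike.ext_iff.1 h b.unop
  exact isNoetherian_iff'.2 hΦ.wellFoundedGT

theorem finiteType_op (k A : Type*) [Field k] [Ring A] [Algebra k A] [Algebra.FiniteType k A] :
    Algebra.FiniteType k Aᵐᵒᵖ := by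
  classical
  obtain ⟨S, hS⟩ := Algebra.FiniteType.out (R := k) (A := A)
  refine ⟨⟨S.image MulOpposite.op, ?_⟩⟩
  have h := Subalgebra.op_adjoin (R := k) (S : Set A)
  rw [hS] at h
  have himage : MulOpposite.op '' (S : Set A) = MulOpposite.unop ⁻¹' (S : Set A) :=
    MulOpposite.opEquiv.image_eq_preimage_symm _
  rw [Finset.coe_image, himage, ← h]
  rfl

end Opposite

section GelfandKirillov

variable {k A : Type} [Field k] [Ring A] [Algebra k A] {M : Type} [AddCommGroup M]
  [Module Aᵐᵒᵖ M] [Module k M]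

theorem prodSub_finite [IsScalarTower k Aᵐᵒᵖ M] (V : Submodule k A) (F : Submodule k M) [Module.Finite k V]
    [Module.Finite k F] (n : ℕ) : Module.Finite k (prodSub k A M V F n) := by
  have := finite_sup_one_pow V n
  let f : A →ₗ[k] M →ₗ[k] M := (Algebra.lsmul k k M : Aᵐᵒᵖ →ₐ[k] Module.End k M).toLinearMap ∘ₗ
    (MulOpposite.opLinearEquiv k : A ≃ₗ[k] Aᵐᵒᵖ).toLinearMap
  have h : prodSub k A M V F n = Submodule.map₂ f ((V ⊔ 1) ^ n) F := by
    rw [Submodule.map₂_eq_span_image2]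
    rfl
  rw [h]
  exact Module.Finite.iff_fg.2 (Submodule.FG.map₂ f (Module.Finite.iff_fg.1 this)
    (Module.Finite.iff_fg.1 ‹Module.Finite k F›))

theorem ModGKLE.subquadraticGrowth [IsScalarTower k Aᵐᵒᵖ M] (h : ModGKLE k A M 1) :
    SubquadraticGrowth k Aᵐᵒᵖ M := by
  intro W hW x
  let e := (MulOpposite.opLinearEquiv k : A ≃ₗ[k] Aᵐᵒᵖ)
  let V : Submodule k A := W.map e.symm.toLinearMap
  have hV : Module.Finite k V := Module.Finite.map _ _
  have hx : Module.Finite k (Submodule.span k {x}) := inferInstance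
  obtain ⟨C, hC⟩ := h V (Submodule.span k {x}) hV hx (1 / 2) (by norm_num)
  refine ⟨C, fun n => le_trans (Nat.cast_le.2 ?_) ((hC n).trans_eq (by norm_num))⟩
  have := prodSub_finite V (Submodule.span k {x}) n
  refine Submodule.finrank_mono ?_
  rintro _ ⟨w, hw, rfl⟩
  refine Submodule.subset_span ⟨w.unop, ?_, x, Submodule.mem_span_singleton_self x, rfl⟩
  have hVW : ((V ⊔ 1) ^ n).map e.toLinearMap = (W ⊔ 1) ^ n := by
    rw [Submodule.map_op_pow, Submodule.map_sup, Submodule.map_op_one, ← Submodule.map_comp]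
    simp [e]
  rw [← hVW] at hw
  obtain ⟨v, hv, rfl⟩ := hw
  exact hv

theorem ModGKGE.not_finite (h : ModGKGE k A M 1) : ¬ Module.Finite k M := by
  intro hM
  obtain ⟨V, F, -, -, h⟩ := h
  obtain ⟨N, hN⟩ := exists_nat_gt ((Module.finrank k M : ℝ) ^ 2)
  obtain ⟨n, hNn, hn⟩ := h (1 / 2) (by norm_num) N
  have h1 : (Module.finrank k M : ℝ) < (n : ℝ) ^ (1 / 2 : ℝ) := by
    rw [← Real.sqrt_eq_rpow]
    exact Real.lt_sqrt_of_sq_lt (hN.trans_le (Nat.cast_le.2 hNn))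
  norm_num at hn
  norm_num at h1
  exact absurd (hn.trans (Nat.cast_le.2 (Submodule.finrank_le _))) (not_le.2 h1)

theorem RingGKGE.nontrivial (h : RingGKGE k A 2) : Nontrivial A := by
  by_contra hA
  rw [not_nontrivial_iff_subsingleton] at hA
  obtain ⟨V, -, h⟩ := h
  obtain ⟨n, hn1, hn⟩ := h 1 one_pos 1
  rw [Module.finrank_zero_of_subsingleton] at hn
  norm_num at hn
  omega

/-- In the hereditary Cohen–Macaulay case, proper quotients of the right regular module by right
ideals containing a nonzero ideal have GK-dimension one. -/
theorem gk_quotient_eq_one [IsNoetherianRing Aᵐᵒᵖ] (hCM : CohenMacaulayGK2 k A)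
    (hproj : ∀ J : Submodule Aᵐᵒᵖ Aᵐᵒᵖ, Module.Projective Aᵐᵒᵖ J) (I : Ideal Aᵐᵒᵖ) [I.IsTwoSided]
    (hI : ∀ y : Aᵐᵒᵖ, (∀ i ∈ I, i * y = 0) → y = 0) {J : Ideal Aᵐᵒᵖ} (hIJ : I ≤ J) (hJ : J ≠ ⊤) :
    ModGKLE k A (Aᵐᵒᵖ ⧸ J) 1 ∧ ModGKGE k A (Aᵐᵒᵖ ⧸ J) 1 := by
  have hnt : Nontrivial (Aᵐᵒᵖ ⧸ J) := Submodule.Quotient.nontrivial_iff.2 hJ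
  have key := hCM (Aᵐᵒᵖ ⧸ J) inferInstance hnt 1 ⟨?_, ?_⟩
  · norm_num at key
    exact key
  · by_contra h
    rw [not_nontrivial_iff_subsingleton] at h
    have hproj := hproj J
    refine hJ (eq_of_functionals_extend I hI hIJ le_top fun g => ?_)
    obtain ⟨g', hg'⟩ := exists_extension_of_subsingleton_ext_one J (ModuleCat.of Aᵐᵒᵖ Aᵐᵒᵖ) h g
    exact ⟨g' ∘ₗ (⊤ : Submodule Aᵐᵒᵖ Aᵐᵒᵖ).subtype, hg'⟩
  · intro i hi
    obtain rfl : i = 0 := by omega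
    refine subsingleton_ext_zero fun f => ?_
    refine ModuleCat.hom_ext (LinearMap.ext fun m => hI _ fun i hi => ?_)
    obtain ⟨r, rfl⟩ := Submodule.Quotient.mk_surjective J m
    have h : i • (Submodule.Quotient.mk r : Aᵐᵒᵖ ⧸ J) = 0 := by
      rw [← Submodule.Quotient.mk_smul, Submodule.Quotient.mk_eq_zero]
      exact hIJ (I.mul_mem_right r hi)
    have h2 := f.hom.map_smul i (Submodule.Quotient.mk r)
    rw [h, map_zero] at h2
    exact h2.symm

end GelfandKirillov

theorem stmt_11 (k A : Type) [Field k] [Ring A] [Algebra k A]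
    (hfg : Algebra.FiniteType k A)
    (hprime : IsPrimeRing A)
    (hnoethR : IsNoetherianRing Aᵐᵒᵖ) (hnoethL : IsNoetherianRing A)
    (hAG : AuslanderGorenstein A)
    (hCM : CohenMacaulayGK2 k A)
    (hGK : RingGKLE k A 2 ∧ RingGKGE k A 2)
    (hher : IsHereditaryRing A) :
    IsSimpleRing A := by
  have := hGK.2.nontrivial
  refine IsSimpleRing.of_eq_bot_or_eq_top fun T => ?_
  by_contra! hT
  let I : Ideal Aᵐᵒᵖ := T.op.asIdeal
  have hIT (x : Aᵐᵒᵖ) : x ∈ I ↔ x.unop ∈ T := by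
    rw [TwoSidedIdeal.mem_asIdeal, TwoSidedIdeal.mem_op_iff]
  have hItop : I ≠ ⊤ := fun h => hT.2 <| (TwoSidedIdeal.one_mem_iff T).1
    ((hIT 1).1 (h ▸ Submodule.mem_top))
  have hI (y : Aᵐᵒᵖ) (hy : ∀ i ∈ I, i * y = 0) : y = 0 := by
    obtain ⟨a, haT, ha0⟩ := SetLike.exists_of_lt (bot_lt_iff_ne_bot.2 hT.1)
    have h := hprime y.unop a fun x => by
      have := hy (MulOpposite.op (x * a)) ((hIT _).2 (T.mul_mem_left x a haT))
      rw [mul_assoc]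
      exact congrArg MulOpposite.unop this
    exact MulOpposite.unop_injective (h.resolve_right fun h => ha0 (by simp [h]))
  have hproj (J : Submodule Aᵐᵒᵖ Aᵐᵒᵖ) : Module.Projective Aᵐᵒᵖ J :=
    projective_of_subsingleton_ext_two J fun N => hher.1 _ N 2 one_lt_two
  have := isNoetherian_op_op A
  have := finiteType_op k A
  have := isArtinian_quotient hproj I hI
  obtain ⟨m, hm, hIm⟩ := Ideal.exists_le_maximal I hItop
  have : IsSimpleModule Aᵐᵒᵖ (Aᵐᵒᵖ ⧸ m) := isSimpleModule_iff_isCoatom.2 hm.out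
  have hIM (i : Aᵐᵒᵖ) (hi : i ∈ I) (x : Aᵐᵒᵖ ⧸ m) : i • x = 0 := by
    obtain ⟨r, rfl⟩ := Submodule.Quotient.mk_surjective m x
    rw [← Submodule.Quotient.mk_smul, Submodule.Quotient.mk_eq_zero]
    exact hIm (I.mul_mem_right r hi)
  have := finite_end_of_isArtinian I hIM
  obtain ⟨J, hJ, hMJ, hfin⟩ := exists_ideal_of_subquadraticGrowth
    (gk_quotient_eq_one hCM hproj I hI hIm hm.ne_top).1.subquadraticGrowth
  exact (gk_quotient_eq_one hCM hproj I hI (fun i hi => hMJ i (hIM i hi)) hJ).2.not_finite hfin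

end
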